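/- Let N ≥ 1, m ≥ 1 and l ≥ 2 be integers, let d₁,…,d_m ≥ 1 be integers satisfying l·(d₁+⋯+d_m) ≤ N(l−1) + m, and let G₁,…,G_m ∈ ℂ[x₀,…,x_N] be homogeneous with deg G_i = d_i. Then for any nonzero v, w ∈ ℂ^{N+1} with G_i(v) = G_i(w) = 0 for all i, there exist nonzero vectors p¹,…,p^{l−1} ∈ ℂ^{N+1} such that, setting p⁰ := v and p^l := w, for every k = 1,…,l and every i = 1,…,m the binary form (u, t) ↦ G_i(u·p^{k−1} + t·p^k) is identically zero on ℂ². Consequently each nondegenerate link of the chain is a projective line contained in the common zero locus X of the G_i, so X is rationally chain connected by chains of lines of length at most l. -/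

import Mathlib

open MvPolynomial

/-- Any common zero of complex polynomials in an extension field yields one over `ℂ`. -/
theorem exists_complex_zero_of_zero {σ κ : Type} [Finite σ] [Field κ] [Algebra ℂ κ]
    (x : σ → κ) :
    ∃ y : σ → ℂ, ∀ f : MvPolynomial σ ℂ, aeval x f = 0 → aeval y f = 0 := by
  have hne : RingHom.ker (aeval x : MvPolynomial σ ℂ →ₐ[ℂ] κ) ≠ ⊤ := RingHom.ker_ne_top _
  obtain ⟨M, hM, hle⟩ := Ideal.exists_le_maximal _ hne
  obtain ⟨y, rfl⟩ := isMaximal_iff_eq_vanishingIdeal_singleton.1 hM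
  exact ⟨y, fun f hf => (mem_vanishingIdeal_singleton_iff y f).1 (hle hf)⟩

/-- The ideal of the origin in affine space of dimension `n` has height at least `n`. -/
theorem card_le_height_ker_constantCoeff (σ : Type) [Fintype σ] :
    (Fintype.card σ : ℕ∞) ≤
      (RingHom.ker (constantCoeff : MvPolynomial σ ℂ →+* ℂ)).height := by
  classical
  let φ : Finset σ → (MvPolynomial σ ℂ →ₐ[ℂ] MvPolynomial σ ℂ) :=
    fun S => aeval fun j => if j ∈ S then 0 else X j
  have key : ∀ S : Finset σ, (S.card : ℕ∞) ≤ (RingHom.ker (φ S)).height := by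
    intro S
    induction S using Finset.induction_on with
    | empty => simp
    | insert a S ha ih =>
      have hcomp : (φ (insert a S)) = (φ {a}).comp (φ S) := by
        ext1 j
        by_cases hj : j ∈ S <;> by_cases hja : j = a <;> simp [φ, hj, hja, ha]
      have hlt : RingHom.ker (φ S) < RingHom.ker (φ (insert a S)) := by
        refine lt_of_le_of_ne (fun f hf => ?_) fun h => ?_
        · rw [RingHom.mem_ker] at hf ⊢
          rw [hcomp, AlgHom.comp_apply, hf, map_zero]
        · have : (X a : MvPolynomial σ ℂ) ∈ RingHom.ker (φ S) := by
            rw [h, RingHom.mem_ker]; simp [φ]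
          rw [RingHom.mem_ker] at this
          simp [φ, ha] at this
      have : (RingHom.ker (φ S)).IsPrime := RingHom.ker_isPrime _
      have : (RingHom.ker (φ (insert a S))).IsPrime := RingHom.ker_isPrime _
      rw [Finset.card_insert_of_notMem ha, Nat.cast_add, Nat.cast_one]
      exact (add_le_add_left ih 1).trans (Ideal.height_add_one_le_of_lt_of_isPrime hlt)
  refine (key Finset.univ).trans_eq ?_
  congr 1
  ext f
  simp only [RingHom.mem_ker]
  have : φ Finset.univ f = C (constantCoeff f) := by
    simp only [φ, Finset.mem_univ, if_true]
    exact aeval_zero' f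
  rw [this, C_eq_zero]

/-- Deforming the system `x c ^ e c = 0`, whose only solution is the origin, in the direction of
an arbitrary system `f`: the deformed system has a solution over a field in which the deformation
parameter is transcendental. -/
theorem exists_deformed_zero {Γ : Type} [Fintype Γ] (e : Γ → ℕ) (he : ∀ c, e c ≠ 0)
    (f : Γ → MvPolynomial Γ ℂ) :
    ∃ (K : Type) (_ : Field K) (_ : Algebra ℂ K) (x : Γ → K) (s : K),
      ¬ IsIntegral ℂ s ∧ ∀ c, x c ^ e c + s * aeval x (f c) = 0 := by
  classical
  let q : Γ → MvPolynomial (Option Γ) ℂ :=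
    fun c => X (some c) ^ e c + X none * rename some (f c)
  let m := RingHom.ker (constantCoeff : MvPolynomial (Option Γ) ℂ →+* ℂ)
  have hm : m.IsPrime := RingHom.ker_isPrime _
  have hIm : Ideal.span (Set.range q) ≤ m := by
    rw [Ideal.span_le]
    rintro _ ⟨c, rfl⟩
    simp [q, m, RingHom.mem_ker, he c]
  obtain ⟨P, hP, hPm⟩ := Ideal.exists_minimalPrimes_le hIm
  have hPprime : P.IsPrime := hP.1.1
  have hqP : ∀ c, q c ∈ P := fun c => hP.1.2 (Ideal.subset_span ⟨c, rfl⟩)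
  have hheight : P.height ≤ Fintype.card Γ := by
    have h1 : P ∈ (Ideal.span ((Finset.univ.image q : Finset _) : Set _)).minimalPrimes := by
      simpa using hP
    refine (Ideal.height_le_card_of_mem_minimalPrimes_span_finset h1).trans ?_
    exact_mod_cast Finset.card_image_le
  have hs : (X none : MvPolynomial (Option Γ) ℂ) ∉ P := by
    intro hs
    have hx : ∀ o, (X o : MvPolynomial (Option Γ) ℂ) ∈ P := by
      rintro (_ | c)
      · exact hs
      · refine hPprime.mem_of_pow_mem (e c) ?_
        exact (P.add_mem_iff_left (P.mul_mem_right _ hs)).1 (hqP c)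
    have hmP : m ≤ P := by
      intro g hg
      have h1 : (Ideal.Quotient.mkₐ ℂ P) g = algebraMap ℂ _ (constantCoeff g) := by
        rw [← aeval_zero' (σ := Option Γ)]
        refine DFunLike.congr_fun (f := Ideal.Quotient.mkₐ ℂ P) ?_ g
        ext o
        simpa using Ideal.Quotient.eq_zero_iff_mem.2 (hx o)
      have h0 : constantCoeff g = 0 := hg
      rw [h0, map_zero] at h1
      exact Ideal.Quotient.eq_zero_iff_mem.1 h1
    have := (card_le_height_ker_constantCoeff (Option Γ)).trans
      ((Ideal.height_mono hmP).trans hheight)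
    rw [Fintype.card_option] at this
    have := Nat.cast_le.1 this
    omega
  let A := MvPolynomial (Option Γ) ℂ ⧸ P
  let K := FractionRing A
  let ψ : MvPolynomial (Option Γ) ℂ →ₐ[ℂ] K :=
    (IsScalarTower.toAlgHom ℂ A K).comp (Ideal.Quotient.mkₐ ℂ P)
  have hψ : ∀ g, ψ g = 0 ↔ g ∈ P := by
    intro g
    rw [← Ideal.Quotient.eq_zero_iff_mem]
    exact (map_eq_zero_iff _ (IsFractionRing.injective A K))
  refine ⟨K, inferInstance, inferInstance, fun c => ψ (X (some c)), ψ (X none), ?_, ?_⟩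
  · intro hint
    obtain ⟨z, hz⟩ := IsAlgClosed.algebraMap_bijective_of_isIntegral (k := ℂ)
      (K := integralClosure ℂ K) |>.2 ⟨_, hint⟩
    have hz' : ψ (C z) = ψ (X none) := by
      have := congrArg Subtype.val hz
      rw [← algebraMap_eq, AlgHom.commutes]
      exact this
    have hmem : X none - C z ∈ P := by
      rw [← hψ, map_sub, hz', sub_self]
    have : z = 0 := by
      have := hPm hmem
      simpa [m, RingHom.mem_ker] using this
    rw [this, C_0, sub_zero] at hmem
    exact hs hmem
  · intro c
    have h := (hψ _).2 (hqP c)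
    have h2 : (aeval fun c => ψ (X (some c))) (f c) = ψ (rename some (f c)) := by
      rw [← AlgHom.comp_apply]
      refine DFunLike.congr_fun ?_ (f c)
      ext c
      simp
    rw [h2]
    simpa [q] using h

theorem exists_valuationSubring_of_not_isIntegral {K : Type*} [Field K] [Algebra ℂ K] {s : K}
    (hs : ¬ IsIntegral ℂ s) :
    ∃ V : ValuationSubring K, (∀ z : ℂ, algebraMap ℂ K z ∈ V) ∧ s ∉ V := by
  have : IsIntegrallyClosedIn (integralClosure ℂ K).toSubring K :=
    inferInstanceAs (IsIntegrallyClosedIn (integralClosure ℂ K) K)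
  obtain ⟨V, hV, hsV⟩ := Subring.exists_le_valuationSubring_of_isIntegrallyClosedIn
    (R := (integralClosure ℂ K).toSubring) (x := s) hs
  exact ⟨V, fun z => hV ((integralClosure ℂ K).algebraMap_mem z), hsV⟩

/-- A family of elements containing `1` can be rescaled into a valuation ring so that one of its
members becomes `1`. -/
theorem ValuationSubring.exists_rescale {K : Type*} [Field K] (V : ValuationSubring K)
    {τ : Type*} [Finite τ] (p : τ → K) (j₀ : τ) (hj₀ : p j₀ = 1) :
    ∃ a : K, a ≠ 0 ∧ (∀ j, a * p j ∈ V) ∧ ∃ i, a * p i = 1 := by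
  have : Nonempty τ := ⟨j₀⟩
  obtain ⟨i, hi⟩ := Finite.exists_max fun j => V.valuation (p j)
  have hpi : p i ≠ 0 := by
    intro h
    have := hi j₀
    simp [hj₀, h] at this
  refine ⟨(p i)⁻¹, inv_ne_zero hpi, fun j => ?_, i, inv_mul_cancel₀ hpi⟩
  rw [← V.valuation_le_one_iff, map_mul, map_inv₀, mul_comm, ← div_eq_mul_inv]
  exact div_le_one_of_le₀ (hi j) zero_le

/-- A polynomial in blocks of variables indexed by `ι` is multihomogeneous of multidegree `δ` if,
over every field, rescaling the blocks rescales its values according to `δ`. -/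
def IsMultihomogeneous {ι τ : Type} [Fintype ι] (F : MvPolynomial (ι × τ) ℂ) (δ : ι → ℕ) : Prop :=
  ∀ (K : Type) [Field K] [Algebra ℂ K] (a : ι → K) (p : ι × τ → K), (∀ k, a k ≠ 0) →
    aeval (fun x => a x.1 * p x) F = (∏ k, a k ^ δ k) * aeval p F

theorem exists_multiprojective_zero_of_full {ι : Type} [Fintype ι] {N : ℕ}
    (F : ι × Fin N → MvPolynomial (ι × Fin (N + 1)) ℂ) (δ : ι × Fin N → ι → ℕ)
    (hF : ∀ c, IsMultihomogeneous (F c) (δ c)) (hδ : ∀ c, δ c c.1 ≠ 0) :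
    ∃ p : ι × Fin (N + 1) → ℂ, (∀ k, ∃ i, p (k, i) ≠ 0) ∧ ∀ c, aeval p (F c) = 0 := by
  classical
  let chart : ∀ {R : Type} [CommRing R], (ι × Fin N → R) → ι × Fin (N + 1) → R :=
    fun x b => Fin.cons (α := fun _ => _) 1 (fun i => x (b.1, i)) b.2
  obtain ⟨K, _, _, x, s, hs, hx⟩ := exists_deformed_zero (fun c => δ c c.1) hδ
    (fun c => aeval (chart (X : _ → MvPolynomial (ι × Fin N) ℂ)) (F c))
  have hchart : ∀ c, aeval x (aeval (chart (X : _ → MvPolynomial (ι × Fin N) ℂ)) (F c)) =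
      aeval (chart x) (F c) := by
    intro c
    rw [← AlgHom.comp_apply]
    refine DFunLike.congr_fun ?_ (F c)
    ext ⟨k, i⟩
    refine Fin.cases ?_ (fun i => ?_) i <;> simp [chart]
  obtain ⟨V, hV, hsV⟩ := exists_valuationSubring_of_not_isIntegral hs
  have hs0 : s ≠ 0 := by
    rintro rfl
    exact hsV V.zero_mem
  choose a ha0 haV i₀ hi₀ using fun k =>
    V.exists_rescale (fun i => chart x (k, i)) 0 (by simp [chart])
  let p : ι × Fin (N + 1) → V := fun b => ⟨a b.1 * chart x b, haV b.1 b.2⟩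
  let ε : V := ⟨s⁻¹, (V.mem_or_inv_mem s).resolve_left hsV⟩
  have hε : ε ∈ IsLocalRing.maximalIdeal V := by
    rw [IsLocalRing.mem_maximalIdeal, mem_nonunits_iff]
    intro hu
    obtain ⟨b, hb⟩ := isUnit_iff_exists_inv.1 hu
    have hb' : s⁻¹ * (b : K) = 1 := congrArg Subtype.val hb
    have : (b : K) = s := by
      field_simp at hb'
      exact hb'
    exact hsV (this ▸ b.2)
  let _ : Algebra ℂ V := ((algebraMap ℂ K).codRestrict V.toSubring hV).toAlgebra
  obtain ⟨incl, hincl⟩ : ∃ f : V →ₐ[ℂ] K, ∀ z, f z = (z : K) :=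
    ⟨{ V.subtype with commutes' := fun _ => rfl }, fun _ => rfl⟩
  have hinj : Function.Injective incl := fun z z' h => Subtype.ext (by rwa [hincl, hincl] at h)
  let res : V →ₐ[ℂ] IsLocalRing.ResidueField V :=
    IsScalarTower.toAlgHom ℂ V (IsLocalRing.ResidueField V)
  have hmem : ∀ c, aeval p (F c) ∈ IsLocalRing.maximalIdeal V := by
    intro c
    have h0 : ∀ k, a k = (p (k, 0) : K) := fun k => by simp [p, chart]
    have h1 : incl (aeval p (F c)) = (∏ k, a k ^ δ c k) * aeval (chart x) (F c) := by
      rw [← hF c K a (chart x) ha0, ← AlgHom.comp_apply]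
      refine DFunLike.congr_fun ?_ (F c)
      ext b
      simp [p, hincl]
    have h2 : aeval (chart x) (F c) = -(s⁻¹ * x c ^ δ c c.1) := by
      have := hx c
      rw [hchart] at this
      field_simp
      linear_combination this
    have h3 : a c.1 * x c = (p (c.1, c.2.succ) : K) := by simp [p, chart]
    have h4 : aeval p (F c) =
        ε * -((∏ k ∈ Finset.univ.erase c.1, p (k, 0) ^ δ c k) *
          p (c.1, c.2.succ) ^ δ c c.1) := by
      apply hinj
      rw [h1, h2, ← Finset.mul_prod_erase _ _ (Finset.mem_univ c.1)]
      simp only [map_mul, map_neg, map_prod, map_pow]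
      simp only [hincl, ← h0, ← h3]
      change _ = s⁻¹ * _
      ring
    rw [h4]
    exact Ideal.mul_mem_right _ _ hε
  obtain ⟨y, hy⟩ := exists_complex_zero_of_zero fun b => res (p b)
  refine ⟨y, fun k => ⟨i₀ k, ?_⟩, fun c => hy _ ?_⟩
  · have h : aeval (fun b => res (p b)) (X (k, i₀ k) - 1 : MvPolynomial (ι × Fin (N + 1)) ℂ) = 0 := by
      have : p (k, i₀ k) = 1 := Subtype.val_injective (hi₀ k)
      simp [this]
    have := hy _ h
    simp only [map_sub, aeval_X, map_one, sub_eq_zero] at this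
    simp [this]
  · have : aeval (fun b => res (p b)) (F c) = res (aeval p (F c)) := by
      rw [← AlgHom.comp_apply]
      refine DFunLike.congr_fun ?_ (F c)
      ext b
      simp
    rw [this]
    exact (IsLocalRing.residue_eq_zero_iff _).2 (hmem c)

/-- A system of multihomogeneous equations on a product of copies of `ℙ^N` is solvable as soon as
the equations can be distributed among the factors, each equation going to a factor on which it
depends and each factor receiving at most `N` equations. -/
theorem exists_multiprojective_zero {ι J : Type} [Fintype ι] {N : ℕ}
    (F : J → MvPolynomial (ι × Fin (N + 1)) ℂ) (δ : J → ι → ℕ)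
    (hF : ∀ j, IsMultihomogeneous (F j) (δ j)) (slot : J → ι × Fin N)
    (hslot : Function.Injective slot) (hδ : ∀ j, δ j (slot j).1 ≠ 0) :
    ∃ p : ι × Fin (N + 1) → ℂ, (∀ k, ∃ i, p (k, i) ≠ 0) ∧ ∀ j, aeval p (F j) = 0 := by
  classical
  have hext : ∀ c : ι × Fin N, (∃ j, slot j = c) ∨ ¬ ∃ j, slot j = c := fun c => em _
  obtain ⟨p, hp, hz⟩ := exists_multiprojective_zero_of_full
    (Function.extend slot F 0) (Function.extend slot δ fun _ _ => 1)
    (fun c => by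
      obtain ⟨j, rfl⟩ | h := hext c
      · rw [hslot.extend_apply, hslot.extend_apply]
        exact hF j
      · rw [Function.extend_apply' _ _ _ h, Function.extend_apply' _ _ _ h]
        intro K _ _ a p _
        simp)
    (fun c => by
      obtain ⟨j, rfl⟩ | h := hext c
      · rw [hslot.extend_apply]
        exact hδ j
      · rw [Function.extend_apply' _ _ _ h]
        exact one_ne_zero)
  refine ⟨p, hp, fun j => ?_⟩
  have := hz (slot j)
  rwa [hslot.extend_apply] at this

section Polarization

variable {σ R S K : Type*} [CommRing R] [Algebra ℂ R] [CommRing S] [Algebra ℂ S]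
  [Field K] [Algebra ℂ K]

theorem MvPolynomial.IsHomogeneous.aeval_mul {G : MvPolynomial σ ℂ} {n : ℕ}
    (hG : G.IsHomogeneous n) (a : R) (p : σ → R) :
    MvPolynomial.aeval (fun i => a * p i) G = a ^ n * MvPolynomial.aeval p G := by
  rw [aeval_def, aeval_def, eval₂_eq, eval₂_eq, Finset.mul_sum]
  refine Finset.sum_congr rfl fun m hm => ?_
  simp only [mul_pow, Finset.prod_mul_distrib, Finset.prod_pow_eq_pow_sum]
  rw [← hG.degree_eq_sum_deg_support hm]
  ring

/-- The restriction `T ↦ G (p + T q)` of `G` to the line through `p` in direction `q`. -/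
noncomputable def lineRestriction (G : MvPolynomial σ ℂ) (p q : σ → R) : Polynomial R :=
  aeval (fun i => Polynomial.C (p i) + Polynomial.X * Polynomial.C (q i)) G

theorem map_coeff_lineRestriction (f : R →ₐ[ℂ] S) (G : MvPolynomial σ ℂ) (p q : σ → R) (n : ℕ) :
    f ((lineRestriction G p q).coeff n) =
      (lineRestriction G (fun i => f (p i)) (fun i => f (q i))).coeff n := by
  have : lineRestriction G (fun i => f (p i)) (fun i => f (q i)) =
      Polynomial.mapAlgHom f (lineRestriction G p q) := by
    unfold lineRestriction
    rw [← AlgHom.comp_apply]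
    refine DFunLike.congr_fun ?_ G
    ext1 i
    simp
  rw [this]
  simp

theorem eval_lineRestriction (G : MvPolynomial σ ℂ) (p q : σ → R) (t : R) :
    (lineRestriction G p q).eval t = aeval (fun i => p i + t * q i) G := by
  have h : ((Polynomial.aeval t).restrictScalars ℂ).comp
      (aeval fun i => Polynomial.C (p i) + Polynomial.X * Polynomial.C (q i)) =
      (aeval fun i => p i + t * q i : MvPolynomial σ ℂ →ₐ[ℂ] R) := by
    ext1 i
    simp [mul_comm t]
  rw [← h, ← Polynomial.coe_aeval_eq_eval]
  rfl

theorem coeff_lineRestriction_mul {G : MvPolynomial σ ℂ} {d : ℕ} (hG : G.IsHomogeneous d)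
    {a b : K} (ha : a ≠ 0) (p q : σ → K) {n : ℕ} (hn : n ≤ d) :
    (lineRestriction G (fun i => a * p i) (fun i => b * q i)).coeff n =
      a ^ (d - n) * b ^ n * (lineRestriction G p q).coeff n := by
  have h : lineRestriction G (fun i => a * p i) (fun i => b * q i) =
      Polynomial.C a ^ d * (lineRestriction G p q).comp (Polynomial.C (b / a) * Polynomial.X) := by
    have hcomp : (lineRestriction G p q).comp (Polynomial.C (b / a) * Polynomial.X) =
        aeval (fun i => Polynomial.C (p i) +
          (Polynomial.C (b / a) * Polynomial.X) * Polynomial.C (q i)) G := by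
      have h : ((Polynomial.aeval (Polynomial.C (b / a) * Polynomial.X)).restrictScalars ℂ).comp
          (aeval fun i => Polynomial.C (p i) + Polynomial.X * Polynomial.C (q i)) =
          (aeval fun i => Polynomial.C (p i) +
            (Polynomial.C (b / a) * Polynomial.X) * Polynomial.C (q i) :
              MvPolynomial σ ℂ →ₐ[ℂ] Polynomial K) := by
        ext1 i
        simp
        ring
      rw [← h]
      rfl
    rw [hcomp, ← hG.aeval_mul]
    unfold lineRestriction
    congr 2
    funext i
    have : Polynomial.C b = Polynomial.C a * Polynomial.C (b / a) := by
      rw [← Polynomial.C_mul, mul_div_cancel₀ _ ha]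
    rw [Polynomial.C_mul, Polynomial.C_mul, this]
    ring
  rw [h, ← Polynomial.C_pow, Polynomial.coeff_C_mul, Polynomial.comp_C_mul_X_coeff, div_pow]
  obtain ⟨k, rfl⟩ := Nat.exists_eq_add_of_le hn
  rw [Nat.add_sub_cancel_left, pow_add]
  field_simp

/-- A homogeneous polynomial vanishes on a whole line as soon as it vanishes at two points of the
line and the mixed coefficients of its restriction are zero. -/
theorem eval_line_eq_zero {G : MvPolynomial σ ℂ} {d : ℕ} (hG : G.IsHomogeneous d)
    {p q : σ → ℂ} (hp : eval p G = 0) (hq : eval q G = 0)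
    (hmixed : ∀ n, 0 < n → n < d → (lineRestriction G p q).coeff n = 0) (u t : ℂ) :
    eval (u • p + t • q) G = 0 := by
  have hdeg : (lineRestriction G p q).natDegree ≤ d := by
    rw [← mul_one d]
    refine aeval_natDegree_le G hG.totalDegree_le _ fun i => ?_
    compute_degree
  set c := (lineRestriction G p q).coeff d with hc
  have hmono : lineRestriction G p q = Polynomial.C c * Polynomial.X ^ d := by
    ext n
    rw [Polynomial.coeff_C_mul_X_pow]
    split_ifs with h
    · rw [h]
    · obtain h' | h' := lt_or_gt_of_ne h
      · obtain rfl | h0 := Nat.eq_zero_or_pos n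
        · rw [Polynomial.coeff_zero_eq_eval_zero, eval_lineRestriction]
          simp only [zero_mul, add_zero]
          exact hp
        · exact hmixed n h0 h'
      · exact Polynomial.coeff_eq_zero_of_natDegree_lt (hdeg.trans_lt h')
  have hval : ∀ u t : ℂ, u ≠ 0 → eval (u • p + t • q) G = c * t ^ d := by
    intro u t hu
    have h1 : u • p + t • q = fun i => u * (p i + t / u * q i) := by
      funext i
      simp only [Pi.add_apply, Pi.smul_apply, smul_eq_mul]
      field_simp
    have h2 := hG.aeval_mul u (fun i => p i + t / u * q i)
    rw [← eval_lineRestriction, hmono] at h2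
    rw [h1, ← coe_aeval_eq_eval]
    refine h2.trans ?_
    simp only [Polynomial.eval_mul, Polynomial.eval_C, Polynomial.eval_pow, Polynomial.eval_X, div_pow]
    field_simp
  have hc0 : c = 0 := by
    have hcont : Continuous fun u : ℂ => eval (u • p + (1 : ℂ) • q) G := by
      refine (MvPolynomial.continuous_eval G).comp ?_
      fun_prop
    have hconst := Continuous.ext_on (dense_compl_singleton (0 : ℂ)) hcont continuous_const
      (fun u hu => hval u 1 hu)
    have := congrFun hconst 0
    simpa [hq] using this.symm
  obtain rfl | hu := eq_or_ne u 0
  · have := hG.aeval_mul t q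
    rw [zero_smul, zero_add]
    refine this.trans ?_
    rw [show aeval q G = 0 from hq, mul_zero]
  · rw [hval u t hu, hc0, zero_mul]

end Polarization

section Chain

variable {R S τ : Type*} [CommRing R] [Algebra ℂ R] [CommRing S] [Algebra ℂ S] {r : ℕ}

/-- The chain of points starting at `v`, ending at `w`, with the blocks of `q` in between. -/
noncomputable def chainPoint (v w : τ → ℂ) (q : Fin r × τ → R) : Fin (r + 2) → τ → R :=
  Fin.cons (fun i => algebraMap ℂ R (v i))
    (Fin.snoc (α := fun _ => τ → R) (fun k i => q (k, i)) fun i => algebraMap ℂ R (w i))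

theorem forall_chain_index {motive : Fin (r + 2) → Prop} (zero : motive 0)
    (inner : ∀ k : Fin r, motive k.castSucc.succ) (last : motive (Fin.last (r + 1))) (n) :
    motive n := by
  refine Fin.cases zero (fun n => ?_) n
  exact Fin.lastCases last inner n

@[simp] theorem chainPoint_zero (v w : τ → ℂ) (q : Fin r × τ → R) :
    chainPoint v w q 0 = fun i => algebraMap ℂ R (v i) := rfl

@[simp] theorem chainPoint_inner (v w : τ → ℂ) (q : Fin r × τ → R) (k : Fin r) :
    chainPoint v w q k.castSucc.succ = fun i => q (k, i) := by
  simp only [chainPoint, Fin.cons_succ, Fin.snoc_castSucc]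

@[simp] theorem chainPoint_last (v w : τ → ℂ) (q : Fin r × τ → R) :
    chainPoint v w q (Fin.last (r + 1)) = fun i => algebraMap ℂ R (w i) := by
  rw [← Fin.succ_last]
  simp only [chainPoint, Fin.cons_succ, Fin.snoc_last]

theorem map_chainPoint (f : R →ₐ[ℂ] S) (v w : τ → ℂ) (q : Fin r × τ → R) (n : Fin (r + 2)) :
    (fun i => f (chainPoint v w q n i)) = chainPoint v w (fun b => f (q b)) n := by
  induction n using forall_chain_index <;> simp

theorem chainPoint_mul (a : Fin r → R) (v w : τ → ℂ) (q : Fin r × τ → R) (n : Fin (r + 2)) :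
    chainPoint v w (fun b => a b.1 * q b) n =
      fun i => chainPoint 1 1 (fun b : Fin r × Unit => a b.1) n () * chainPoint v w q n i := by
  induction n using forall_chain_index <;> simp

theorem prod_pow_ite_eq (a : Fin r → R) (n : Fin (r + 2)) (e : ℕ) :
    ∏ k, a k ^ (if k.castSucc.succ = n then e else 0) =
      chainPoint 1 1 (fun b : Fin r × Unit => a b.1) n () ^ e := by
  induction n using forall_chain_index with
  | zero => simp [Fin.succ_ne_zero]
  | inner k => simp [pow_ite]
  | last =>
    have h : ∀ k : Fin r, k.castSucc.succ ≠ Fin.last (r + 1) := fun k => by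
      rw [Fin.succ_castSucc]
      exact Fin.castSucc_ne_last _
    simp [h]

/-- The edges of a path with `r` inner vertices, taken `E` times each, can be distributed among
their inner endpoints without exceeding the capacity `C` of any vertex. -/
theorem exists_edge_slots {r E C : ℕ} (h : (r + 1) * E ≤ C * r) :
    ∃ slot : Fin (r + 1) × Fin E → Fin r × Fin C, Function.Injective slot ∧
      ∀ b, (slot b).1.castSucc = b.1 ∨ (slot b).1.succ = b.1 := by
  obtain rfl | hE := Nat.eq_zero_or_pos E
  · exact ⟨fun b => b.2.elim0, fun b => b.2.elim0, fun b => b.2.elim0⟩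
  have hEC : E ≤ C := by
    by_contra! hlt
    have : C * r ≤ E * r := Nat.mul_le_mul_right _ hlt.le
    nlinarith
  obtain ⟨D, rfl⟩ := Nat.exists_eq_add_of_le hEC
  have hD : E ≤ r * D := by nlinarith
  have hlast : ∀ k : Fin (r + 1), ∀ e, e < E - k * D → (k : ℕ) < r := by
    intro k e he
    by_contra! hk
    have : r * D ≤ k * D := Nat.mul_le_mul_right _ hk
    omega
  have hfirst : ∀ k : Fin (r + 1), ∀ e < E, ¬ e < E - k * D → (k : ℕ) - 1 < r ∧ 0 < (k : ℕ) := by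
    intro k e heE he
    have : 0 < (k : ℕ) := by
      by_contra! hk
      have : (k : ℕ) = 0 := by omega
      rw [this] at he
      omega
    omega
  let slot : Fin (r + 1) × Fin E → Fin r × Fin (E + D) := fun b =>
    if hb : (b.2 : ℕ) < E - b.1 * D then
      (⟨b.1, hlast _ _ hb⟩, ⟨b.2, by omega⟩)
    else (⟨b.1 - 1, (hfirst _ _ b.2.2 hb).1⟩, ⟨D + b.2, by omega⟩)
  have hmixed : ∀ (k k' : Fin (r + 1)) (e e' : Fin E), (e : ℕ) < E - k * D →
      ¬ (e' : ℕ) < E - k' * D → 0 < (k' : ℕ) → (k : ℕ) = k' - 1 → (e : ℕ) ≠ D + e' := by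
    intro k k' e e' h1 h2 h3 h4 h5
    have : (k' : ℕ) * D = k * D + D := by
      rw [show (k' : ℕ) = k + 1 by omega, add_mul, one_mul]
    omega
  refine ⟨slot, ?_, ?_⟩
  · rintro ⟨k, e⟩ ⟨k', e'⟩ heq
    simp only [slot] at heq
    split_ifs at heq with h1 h2 h2 <;> simp only [Prod.mk.injEq, Fin.mk.injEq] at heq
    · exact Prod.ext (Fin.ext heq.1) (Fin.ext heq.2)
    · exact (hmixed k k' e e' h1 h2 (hfirst _ _ e'.2 h2).2 heq.1 heq.2).elim
    · exact (hmixed k' k e' e h2 h1 (hfirst _ _ e.2 h1).2 heq.1.symm heq.2.symm).elim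
    · have h3 := (hfirst _ _ e.2 h1).2
      have h4 := (hfirst _ _ e'.2 h2).2
      obtain ⟨heq₁, heq₂⟩ := heq
      exact Prod.ext (Fin.ext (by dsimp only; omega)) (Fin.ext (by dsimp only; omega))
  · rintro ⟨k, e⟩
    simp only [slot]
    split_ifs with h1
    · exact Or.inl rfl
    · have := (hfirst _ _ e.2 h1).2
      exact Or.inr (Fin.ext (by simp only [Fin.val_succ]; omega))

end Chain

/-- Explicit form of the main chain-connectedness theorem: under the numerical
hypothesis `l * ∑ d i ≤ N * (l - 1) + m`, for any two nonzero common zeros `v, w` of the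
`G i` there are nonzero connection points `p¹, …, p^{l-1}` such that every binary form
obtained by restricting each `G i` to each link of the chain is identically zero. -/
theorem chain_connected_explicit
    (N m l : ℕ) (hN : 1 ≤ N) (hm : 1 ≤ m) (hl : 2 ≤ l)
    (d : Fin m → ℕ) (hd : ∀ i, 1 ≤ d i)
    (G : Fin m → MvPolynomial (Fin (N + 1)) ℂ)
    (hG : ∀ i, (G i).IsHomogeneous (d i))
    (hnum : l * (∑ i, d i) ≤ N * (l - 1) + m)
    (v w : Fin (N + 1) → ℂ) (hv : v ≠ 0) (hw : w ≠ 0)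
    (hGv : ∀ i, MvPolynomial.eval v (G i) = 0)
    (hGw : ∀ i, MvPolynomial.eval w (G i) = 0) :
    ∃ p : Fin (l + 1) → (Fin (N + 1) → ℂ),
      p 0 = v ∧ p (Fin.last l) = w ∧ (∀ k, p k ≠ 0) ∧
      ∀ (k : Fin l) (i : Fin m) (u t : ℂ),
        MvPolynomial.eval (u • p k.castSucc + t • p k.succ) (G i) = 0 := by
  obtain ⟨r, rfl⟩ : ∃ r, l = r + 1 := ⟨l - 1, by omega⟩
  rw [Nat.add_sub_cancel] at hnum
  have hr : 1 ≤ r := by omega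
  set E := ∑ i, (d i - 1) with hE
  have hsum : ∑ i, d i = E + m := by
    have : ∑ i, d i = ∑ i : Fin m, ((d i - 1) + 1) :=
      Finset.sum_congr rfl fun i _ => (Nat.sub_add_cancel (hd i)).symm
    simpa [Finset.sum_add_distrib] using this
  rw [hsum] at hnum
  have hmN : m ≤ N := by
    by_contra! hlt
    have h1 : N * r + r ≤ m * r := by
      rw [← Nat.succ_mul]
      exact Nat.mul_le_mul_right _ hlt
    nlinarith [Nat.zero_le ((r + 1) * E)]
  obtain ⟨C, rfl⟩ := Nat.exists_eq_add_of_le' hmN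
  obtain ⟨slot, hslot, hinc⟩ := exists_edge_slots (r := r) (E := E) (C := C) (by nlinarith)
  let mixed : (Σ i : Fin m, Fin (d i - 1)) ≃ Fin E :=
    Fintype.equivFinOfCardEq (by simp [hE])
  let P : Fin (r + 2) → Fin (C + m + 1) → MvPolynomial (Fin r × Fin (C + m + 1)) ℂ :=
    chainPoint v w X
  have hP : ∀ {K : Type} [Field K] [Algebra ℂ K] (q : Fin r × Fin (C + m + 1) → K) n,
      (fun i => aeval q (P n i)) = chainPoint v w q n := by
    intro K _ _ q n
    simpa using map_chainPoint (aeval q) v w X n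
  have hcoeff : ∀ {K : Type} [Field K] [Algebra ℂ K] (q : Fin r × Fin (C + m + 1) → K)
      (i : Fin m) (k : Fin (r + 1)) (n : ℕ),
      aeval q ((lineRestriction (G i) (P k.castSucc) (P k.succ)).coeff n) =
        (lineRestriction (G i) (chainPoint v w q k.castSucc) (chainPoint v w q k.succ)).coeff n := by
    intro K _ _ q i k n
    rw [map_coeff_lineRestriction, hP, hP]
  have hvertex : ∀ {K : Type} [Field K] [Algebra ℂ K] (q : Fin r × Fin (C + m + 1) → K)
      (i : Fin m) (k : Fin r),
      aeval q (rename (fun j => (k, j)) (G i)) = aeval (fun j => q (k, j)) (G i) := by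
    intro K _ _ q i k
    rw [aeval_rename]
    rfl
  let J := (Fin r × Fin m) ⊕ (Fin (r + 1) × Σ i : Fin m, Fin (d i - 1))
  let F : J → MvPolynomial (Fin r × Fin (C + m + 1)) ℂ := Sum.elim
    (fun b => rename (fun j => (b.1, j)) (G b.2))
    (fun b => (lineRestriction (G b.2.1) (P b.1.castSucc) (P b.1.succ)).coeff ((b.2.2 : ℕ) + 1))
  let δ : J → Fin r → ℕ := Sum.elim
    (fun b x => if x = b.1 then d b.2 else 0)
    (fun b x => (if x.castSucc.succ = b.1.castSucc then d b.2.1 - ((b.2.2 : ℕ) + 1) else 0) +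
      if x.castSucc.succ = b.1.succ then (b.2.2 : ℕ) + 1 else 0)
  have hF : ∀ j, IsMultihomogeneous (F j) (δ j) := by
    rintro (⟨k, i⟩ | ⟨k, i, n⟩) K _ _ a q ha
    · simp only [F, δ, Sum.elim_inl, hvertex]
      rw [(hG i).aeval_mul]
      simp [pow_ite]
    · simp only [F, δ, Sum.elim_inr, hcoeff]
      have hscale : ∀ n, chainPoint 1 1 (fun b : Fin r × Unit => a b.1) n () ≠ 0 := by
        intro n
        induction n using forall_chain_index <;> simp [ha]
      rw [chainPoint_mul, chainPoint_mul,
        coeff_lineRestriction_mul (hG i) (hscale _) _ _ (by omega)]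
      simp only [pow_add _ (ite _ _ _), Finset.prod_mul_distrib, prod_pow_ite_eq]
  let slots : J → Fin r × Fin (C + m) := Sum.elim
    (fun b => (b.1, Fin.natAdd C b.2))
    (fun b => ((slot (b.1, mixed b.2)).1, Fin.castAdd m (slot (b.1, mixed b.2)).2))
  have hslots : Function.Injective slots := by
    refine Function.Injective.sumElim ?_ ?_ ?_
    · rintro ⟨k, i⟩ ⟨k', i'⟩ h
      simpa using h
    · rintro ⟨k, b⟩ ⟨k', b'⟩ h
      simp only [Prod.mk.injEq, Fin.castAdd_inj] at h
      simpa using hslot (Prod.ext h.1 h.2)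
    · rintro ⟨k, i⟩ ⟨k', b⟩ h
      have := congrArg (fun c => (c.2 : ℕ)) h
      simp only [Fin.val_natAdd, Fin.val_castAdd] at this
      omega
  have hδ : ∀ j, δ j (slots j).1 ≠ 0 := by
    rintro (⟨k, i⟩ | ⟨k, i, n⟩)
    · simpa [δ, slots] using Nat.one_le_iff_ne_zero.1 (hd i)
    · simp only [δ, slots, Sum.elim_inr]
      obtain h | h := hinc (k, mixed ⟨i, n⟩)
      · simp only [h]
        simp
      · rw [Fin.succ_castSucc]
        simp only [h]
        have := n.2
        simp only [if_true]
        omega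
  obtain ⟨y, hy, hyF⟩ := exists_multiprojective_zero F δ hF slots hslots hδ
  have hzero : ∀ n i, eval (chainPoint v w y n) (G i) = 0 := by
    intro n i
    induction n using forall_chain_index with
    | zero => rw [chainPoint_zero]; exact hGv i
    | inner k =>
      rw [chainPoint_inner]
      exact (hvertex y i k).symm.trans (hyF (Sum.inl (k, i)))
    | last => rw [chainPoint_last]; exact hGw i
  refine ⟨chainPoint v w y, rfl, chainPoint_last v w y, fun n => ?_, fun k i u t => ?_⟩
  · induction n using forall_chain_index with
    | zero => exact hv
    | inner k =>
      rw [chainPoint_inner]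
      obtain ⟨i, hi⟩ := hy k
      exact fun h => hi (congrFun h i)
    | last => rw [chainPoint_last]; exact hw
  · refine eval_line_eq_zero (hG i) (hzero _ i) (hzero _ i) (fun n h0 hn => ?_) u t
    have := hyF (Sum.inr (k, ⟨i, ⟨n - 1, by omega⟩⟩))
    simp only [F, Sum.elim_inr, hcoeff] at this
    rwa [Nat.sub_add_cancel h0] at this
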